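/- In the elementary Puiseux monoid M = ⟨1/p : p prime⟩, the set of lengths of the element 2 is exactly the set of Goldbach numbers: L(2) = { p + q : p, q prime }. -/

import Mathlib

open scoped BigOperators

/-- A Puiseux monoid: an additive submonoid of ℚ consisting of nonnegative elements. -/
def IsPuiseux (M : AddSubmonoid ℚ) : Prop := ∀ x ∈ M, (0:ℚ) ≤ x

/-- `a` is an atom of the submonoid `S`. -/
def IsAtomOf {α : Type*} [AddCommMonoid α] (S : AddSubmonoid α) (a : α) : Prop :=
  a ∈ S ∧ a ≠ 0 ∧ ∀ u v : α, u ∈ S → v ∈ S → a = u + v → u = 0 ∨ v = 0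

/-- `x` has a factorization of length `n` into atoms of `S`. -/
def IsLengthOf {α : Type*} [AddCommMonoid α] (S : AddSubmonoid α) (x : α) (n : ℕ) : Prop :=
  ∃ f : Fin n → α, (∀ i, IsAtomOf S (f i)) ∧ x = ∑ i, f i

/-- The set of lengths of `x` in `S`. -/
def lengthsOf {α : Type*} [AddCommMonoid α] (S : AddSubmonoid α) (x : α) : Set ℕ :=
  {n | IsLengthOf S x n}

/-- `S` is atomic: every nonzero element is a finite sum of atoms. -/
def AtomicM {α : Type*} [AddCommMonoid α] (S : AddSubmonoid α) : Prop :=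
  ∀ x ∈ S, x ≠ 0 → ∃ n : ℕ, IsLengthOf S x n

/-- The system of sets of lengths of `M`. -/
def systemOfLengths (M : AddSubmonoid ℚ) : Set (Set ℕ) :=
  {S | ∃ x ∈ M, lengthsOf M x = S}

/-- The elementary Puiseux monoid ⟨1/p : p prime⟩. -/
def elemPM : AddSubmonoid ℚ :=
  AddSubmonoid.closure {q : ℚ | ∃ p : ℕ, p.Prime ∧ q = 1 / p}

/-- Sum of reciprocals of a multiset of naturals. -/
def recSum (m : Multiset ℕ) : ℚ := (m.map (fun p : ℕ => (1 : ℚ) / p)).sum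

lemma recSum_cons (a : ℕ) (m : Multiset ℕ) : recSum (a ::ₘ m) = 1 / a + recSum m := by
  simp [recSum]

lemma recSum_add (a m : Multiset ℕ) : recSum (a + m) = recSum a + recSum m := by
  simp [recSum]

lemma recSum_replicate (n a : ℕ) : recSum (Multiset.replicate n a) = n / a := by
  simp [recSum, div_eq_mul_inv]

lemma recSum_nonneg (m : Multiset ℕ) : 0 ≤ recSum m := by
  induction m using Multiset.induction_on with
  | empty => simp [recSum]
  | cons a m ih => rw [recSum_cons]; positivity

lemma recSum_frac (p : ℕ) (hp : p.Prime) (m : Multiset ℕ)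
    (hm : ∀ q ∈ m, q.Prime ∧ q ≠ p) :
    ∃ A B : ℤ, ¬ (p : ℤ) ∣ B ∧ recSum m * B = A := by
  induction m using Multiset.induction_on with
  | empty =>
    refine ⟨0, 1, ?_, by simp [recSum]⟩
    intro h
    exact hp.one_lt.ne' (by exact_mod_cast Int.eq_one_of_dvd_one (by positivity) h)
  | cons a m ih =>
    obtain ⟨A, B, hB, h⟩ := ih (fun q hq => hm q (Multiset.mem_cons_of_mem hq))
    obtain ⟨ha, hap⟩ := hm a (Multiset.mem_cons_self a m)
    refine ⟨B + a * A, a * B, ?_, ?_⟩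
    · intro hd
      rcases (Nat.prime_iff_prime_int.mp hp).dvd_or_dvd hd with h1 | h1
      · exact hap ((Nat.prime_dvd_prime_iff_eq hp ha).mp (by exact_mod_cast h1)).symm
      · exact hB h1
    · have : (a : ℚ) ≠ 0 := by exact_mod_cast ha.ne_zero
      rw [recSum_cons]
      push_cast
      rw [← h]
      field_simp

lemma dvd_count (p : ℕ) (hp : p.Prime) (m : Multiset ℕ) (hm : ∀ q ∈ m, q.Prime)
    (N k : ℤ) (h : recSum m = N + k / p) : (p : ℤ) ∣ (m.count p : ℤ) - k := by
  obtain ⟨A, B, hB, hAB⟩ := recSum_frac p hp (m.filter (fun q => ¬ q = p))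
    (fun q hq => ⟨hm q (Multiset.mem_filter.mp hq).1, (Multiset.mem_filter.mp hq).2⟩)
  have hs : m = Multiset.replicate (m.count p) p + m.filter (fun q => ¬ q = p) := by
    conv_lhs => rw [← Multiset.filter_add_not (fun q => q = p) m]
    rw [Multiset.filter_eq']
  have hsum := congrArg recSum hs
  rw [recSum_add, recSum_replicate, h] at hsum
  have hp0 : (p : ℚ) ≠ 0 := by exact_mod_cast hp.ne_zero
  have key : ((m.count p : ℤ) - k) * B = p * (N * B - A) := by
    have : (((m.count p : ℤ) : ℚ) - k) * B = p * (N * B - A) := by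
      rw [← hAB]
      field_simp at hsum
      push_cast
      linear_combination (-B : ℚ) * hsum
    exact_mod_cast this
  exact ((Nat.prime_iff_prime_int.mp hp).dvd_or_dvd ⟨_, key⟩).resolve_right hB

lemma mem_elemPM {x : ℚ} (hx : x ∈ elemPM) :
    ∃ m : Multiset ℕ, (∀ q ∈ m, q.Prime) ∧ x = recSum m := by
  unfold elemPM at hx
  induction hx using AddSubmonoid.closure_induction with
  | mem x hx =>
    obtain ⟨p, hp, rfl⟩ := hx
    exact ⟨{p}, by simpa using hp, by simp [recSum]⟩
  | zero => exact ⟨0, by simp, by simp [recSum]⟩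
  | add x y _ _ hx hy =>
    obtain ⟨a, ha, rfl⟩ := hx
    obtain ⟨b, hb, rfl⟩ := hy
    refine ⟨a + b, ?_, (recSum_add a b).symm⟩
    intro q hq
    rcases Multiset.mem_add.mp hq with h | h
    exacts [ha q h, hb q h]

lemma inv_mem (p : ℕ) (hp : p.Prime) : (1 : ℚ) / p ∈ elemPM :=
  AddSubmonoid.subset_closure ⟨p, hp, rfl⟩

lemma recSum_mem (m : Multiset ℕ) (hm : ∀ q ∈ m, q.Prime) : recSum m ∈ elemPM := by
  apply AddSubmonoid.multiset_sum_mem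
  intro x hx
  obtain ⟨p, hp, rfl⟩ := Multiset.mem_map.mp hx
  exact inv_mem p (hm p hp)

lemma aux_zero (p : ℕ) (a b : Multiset ℕ) (h : (1 : ℚ) / p = recSum a + recSum b)
    (ha : p ∈ a) : recSum b = 0 := by
  obtain ⟨t, rfl⟩ := Multiset.exists_cons_of_mem ha
  rw [recSum_cons] at h
  linarith [recSum_nonneg t, recSum_nonneg b]

lemma isAtom_inv (p : ℕ) (hp : p.Prime) : IsAtomOf elemPM ((1 : ℚ) / p) := by
  have hp0 : (p : ℚ) ≠ 0 := by exact_mod_cast hp.ne_zero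
  refine ⟨inv_mem p hp, by positivity, ?_⟩
  intro u v hu hv h
  obtain ⟨a, ha, rfl⟩ := mem_elemPM hu
  obtain ⟨b, hb, rfl⟩ := mem_elemPM hv
  by_cases h1 : p ∈ a
  · exact Or.inr (aux_zero p a b h h1)
  by_cases h2 : p ∈ b
  · exact Or.inl (aux_zero p b a (by rw [h, add_comm]) h2)
  exfalso
  have hd := dvd_count p hp (a + b)
    (fun q hq => (Multiset.mem_add.mp hq).elim (ha q) (hb q)) 0 1
    (by rw [recSum_add, ← h]; simp)
  rw [Multiset.count_eq_zero_of_notMem (by simp [h1, h2])] at hd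
  have h3 : (p : ℤ) ∣ 1 := by simpa using hd
  exact hp.one_lt.ne' (by exact_mod_cast Int.eq_one_of_dvd_one (by positivity) h3)

lemma atom_eq {x : ℚ} (hx : IsAtomOf elemPM x) : ∃ p : ℕ, p.Prime ∧ x = 1 / p := by
  obtain ⟨hm, h0, hs⟩ := hx
  obtain ⟨m, hp, rfl⟩ := mem_elemPM hm
  induction m using Multiset.induction_on with
  | empty => simp [recSum] at h0
  | cons a t _ =>
    have ha := hp a (Multiset.mem_cons_self a t)
    refine ⟨a, ha, ?_⟩
    rcases hs _ _ (inv_mem a ha)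
      (recSum_mem t (fun q hq => hp q (Multiset.mem_cons_of_mem hq))) (recSum_cons a t) with h | h
    · have : (a : ℚ) ≠ 0 := by exact_mod_cast ha.ne_zero
      exact absurd h (by positivity)
    · rw [recSum_cons, h, add_zero]

lemma peel (m : Multiset ℕ) (hm : ∀ q ∈ m, q.Prime) (N : ℕ) (h : recSum m = N + 1) :
    ∃ (p : ℕ) (t : Multiset ℕ), p.Prime ∧ m = Multiset.replicate p p + t ∧
      (∀ q ∈ t, q.Prime) ∧ recSum t = N := by
  have hne : m ≠ 0 := by
    rintro rfl
    simp only [recSum, Multiset.map_zero, Multiset.sum_zero] at h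
    have : (0 : ℚ) ≤ N := by positivity
    linarith
  obtain ⟨p, hpm⟩ := Multiset.exists_mem_of_ne_zero hne
  have hp := hm p hpm
  have hd := dvd_count p hp m hm (N + 1) 0 (by rw [h]; push_cast; simp)
  have hd' : p ∣ m.count p := by
    rw [sub_zero] at hd; exact_mod_cast hd
  have hle : p ≤ m.count p := Nat.le_of_dvd (Multiset.count_pos.mpr hpm) hd'
  obtain ⟨t, rfl⟩ := Multiset.le_iff_exists_add.mp (Multiset.le_count_iff_replicate_le.mp hle)
  refine ⟨p, t, hp, rfl, fun q hq => hm q (Multiset.mem_add.mpr (Or.inr hq)), ?_⟩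
  have hp0 : (p : ℚ) ≠ 0 := by exact_mod_cast hp.ne_zero
  rw [recSum_add, recSum_replicate, div_self hp0] at h
  linarith

/-- In the elementary Puiseux monoid, the set of lengths of 2 is the set of
Goldbach numbers. -/
theorem stmt13 :
    lengthsOf elemPM (2 : ℚ) =
      {n : ℕ | ∃ p q : ℕ, p.Prime ∧ q.Prime ∧ n = p + q} := by
  ext n
  constructor
  · rintro ⟨f, hf, hsum⟩
    choose g hg hfg using fun i => atom_eq (hf i)
    have hS : recSum (Finset.univ.val.map g) = 2 := by
      rw [hsum]
      simp only [recSum, Multiset.map_map, Function.comp_def, Finset.sum, hfg]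
    obtain ⟨p, t, hp, hmt, ht, hts⟩ := peel (Finset.univ.val.map g) (by
      intro q hq
      obtain ⟨i, _, rfl⟩ := Multiset.mem_map.mp hq
      exact hg i) 1 (by rw [hS]; norm_num)
    obtain ⟨q, s, hq, hts', hs, hss⟩ := peel t ht 0 (by rw [hts]; norm_num)
    have hs0 : s = 0 := by
      induction s using Multiset.induction_on with
      | empty => rfl
      | cons a s _ =>
        exfalso
        have ha := (hs a (Multiset.mem_cons_self a s)).pos
        have : (0 : ℚ) < 1 / a := by positivity
        rw [recSum_cons] at hss
        have := recSum_nonneg s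
        push_cast at hss
        linarith
    refine ⟨p, q, hp, hq, ?_⟩
    have := congrArg Multiset.card hmt
    rw [hts', hs0] at this
    simpa using this
  · rintro ⟨p, q, hp, hq, rfl⟩
    have hp0 : (p : ℚ) ≠ 0 := by exact_mod_cast hp.ne_zero
    have hq0 : (q : ℚ) ≠ 0 := by exact_mod_cast hq.ne_zero
    refine ⟨Fin.append (fun _ => 1 / (p : ℚ)) (fun _ => 1 / (q : ℚ)), ?_, ?_⟩
    · intro i
      induction i using Fin.addCases with
      | left i => rw [Fin.append_left]; exact isAtom_inv p hp
      | right i => rw [Fin.append_right]; exact isAtom_inv q hq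
    · rw [Fin.sum_univ_add]
      simp [hp0, hq0]
      norm_num
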